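/- Let (Z,ρ₀) be an antipodal space and ρ₁, ρ₂ ∈ M(Z). Then for all τ₀ ∈ C(Z): P_∞(τ₀ + log(dρ₁/dρ₂), ρ₂) = P_∞(τ₀, ρ₁). -/

import Mathlib

open Filter Topology
open scoped Classical

variable {Z : Type*}

/-- `Z` has at least four points. -/
def HasFourPoints (Z : Type*) : Prop :=
  ∃ a b c d : Z, a ≠ b ∧ a ≠ c ∧ a ≠ d ∧ b ≠ c ∧ b ≠ d ∧ c ≠ d

/-- A separating function on `Z`: continuous, symmetric, and positive. -/
structure IsSeparating [TopologicalSpace Z] (ρ : Z → Z → ℝ) : Prop where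
  continuous : Continuous fun p : Z × Z => ρ p.1 p.2
  symm : ∀ ξ η, ρ ξ η = ρ η ξ
  nonneg : ∀ ξ η, 0 ≤ ρ ξ η
  eq_zero_iff : ∀ ξ η, ρ ξ η = 0 ↔ ξ = η

/-- The cross-ratio of a quadruple of points with respect to `ρ`. -/
noncomputable def crossRatio (ρ : Z → Z → ℝ) (ξ ξ' η η' : Z) : ℝ :=
  ρ ξ η * ρ ξ' η' / (ρ ξ η' * ρ ξ' η)

/-- Two functions are Moebius equivalent if their cross-ratios agree on all quadruples
of pairwise distinct points. -/
def MoebiusEquiv (ρ₁ ρ₂ : Z → Z → ℝ) : Prop :=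
  ∀ ξ ξ' η η' : Z, ξ ≠ ξ' → ξ ≠ η → ξ ≠ η' → ξ' ≠ η → ξ' ≠ η' → η ≠ η' →
    crossRatio ρ₁ ξ ξ' η η' = crossRatio ρ₂ ξ ξ' η η'

/-- An antipodal function on `Z`: a separating function with values in `[0,1]` such that
every point has an antipode. -/
structure IsAntipodal [TopologicalSpace Z] (ρ : Z → Z → ℝ) : Prop where
  toIsSeparating : IsSeparating ρ
  le_one : ∀ ξ η, ρ ξ η ≤ 1
  antipode : ∀ ξ, ∃ η, ρ ξ η = 1

/-- The Moebius space `M(Z, ρ₀)`: antipodal functions Moebius equivalent to `ρ₀`. -/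
def MoebiusSpace [TopologicalSpace Z] (ρ₀ : Z → Z → ℝ) : Set (Z → Z → ℝ) :=
  {ρ | IsAntipodal ρ ∧ MoebiusEquiv ρ₀ ρ}

/-- The derivative `dρ₂/dρ₁`: the (unique, when it exists) positive continuous function
satisfying the geometric mean value theorem
`ρ₂(ξ,η)² = f(ξ) f(η) ρ₁(ξ,η)²`. -/
noncomputable def mDeriv [TopologicalSpace Z] (ρ₁ ρ₂ : Z → Z → ℝ) : Z → ℝ :=
  if h : ∃ f : Z → ℝ, Continuous f ∧ (∀ ξ, 0 < f ξ) ∧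
      ∀ ξ η, ρ₂ ξ η ^ 2 = f ξ * f η * ρ₁ ξ η ^ 2
  then h.choose else fun _ => 1

/-- The metric `d_M(ρ₁, ρ₂) = ‖log (dρ₂/dρ₁)‖_∞` on the Moebius space. -/
noncomputable def dM [TopologicalSpace Z] (ρ₁ ρ₂ : Z → Z → ℝ) : ℝ :=
  ⨆ ξ : Z, |Real.log (mDeriv ρ₁ ρ₂ ξ)|

/-- The discrepancy function `D_{ρ₁}(τ)(ξ) = max_{η ≠ ξ} (τ(ξ) + τ(η) + log ρ₁(ξ,η)²)`. -/
noncomputable def discrepancy [TopologicalSpace Z] (ρ₁ : Z → Z → ℝ) (τ : C(Z, ℝ))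
    (ξ : Z) : ℝ :=
  ⨆ η : {η : Z // η ≠ ξ}, (τ ξ + τ η.1 + Real.log (ρ₁ ξ η.1 ^ 2))

/-- `E_{ρ₁}(τ)(ξ,η) = e^{τ(ξ)/2} e^{τ(η)/2} ρ₁(ξ,η)`. -/
noncomputable def eMap [TopologicalSpace Z] (ρ₁ : Z → Z → ℝ) (τ : C(Z, ℝ)) :
    Z → Z → ℝ :=
  fun ξ η => Real.exp (τ ξ / 2) * Real.exp (τ η / 2) * ρ₁ ξ η

/-- A solution of the `ρ₁`-antipodal flow `dτ_t/dt = -D_{ρ₁}(τ_t)` on `[0, ∞)`. -/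
def IsAntipodalFlowSol [TopologicalSpace Z] [CompactSpace Z]
    (ρ₁ : Z → Z → ℝ) (τ : ℝ → C(Z, ℝ)) : Prop :=
  ∀ t ∈ Set.Ici (0 : ℝ), ∃ τ' : C(Z, ℝ),
    (∀ ξ, τ' ξ = -discrepancy ρ₁ (τ t) ξ) ∧
    HasDerivWithinAt τ τ' (Set.Ici (0 : ℝ)) t

/-- The antipodalization map `P_∞(τ₀, ρ₁) = E_{ρ₁}(τ_∞)`, where `τ_∞` is the limit as
`t → ∞` of the solution of the `ρ₁`-antipodal flow starting at `τ₀`. -/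
noncomputable def antipodalization [TopologicalSpace Z] [CompactSpace Z]
    (ρ₁ : Z → Z → ℝ) (τ₀ : C(Z, ℝ)) : Z → Z → ℝ :=
  if h : ∃ p : (ℝ → C(Z, ℝ)) × C(Z, ℝ), p.1 0 = τ₀ ∧ IsAntipodalFlowSol ρ₁ p.1 ∧
      Filter.Tendsto p.1 Filter.atTop (𝓝 p.2)
  then eMap ρ₁ h.choose.2 else ρ₁


open Set in
lemma le_of_hasDerivWithinAt_Ici_nonneg {f f' : ℝ → ℝ}
    (hf : ∀ t ∈ Ici (0 : ℝ), HasDerivWithinAt f (f' t) (Ici 0) t) {a b : ℝ} (ha : 0 ≤ a)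
    (hab : a ≤ b) (h : ∀ t ∈ Icc a b, 0 ≤ f' t) : f a ≤ f b := by
  have hsub : Icc a b ⊆ Ici (0 : ℝ) := fun t ht => ha.trans ht.1
  refine monotoneOn_of_hasDerivWithinAt_nonneg (convex_Icc a b) (f' := f')
    (fun t ht => ((hf t (hsub ht)).mono hsub).continuousWithinAt) (fun t ht => ?_) (fun t ht => ?_)
    (left_mem_Icc.2 hab) (right_mem_Icc.2 hab) hab
  · have ht' := interior_subset ht
    exact (hf t (hsub ht')).mono (interior_subset.trans hsub)
  · exact h t (interior_subset ht)

section GlobalExistence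

open Set NNReal

variable [TopologicalSpace Z] [CompactSpace Z]

/-- Pointwise truncation of a continuous function to `[-R, R]`. -/
noncomputable def truncate (R : ℝ) (x : C(Z, ℝ)) : C(Z, ℝ) :=
  ⟨fun ξ => max (-R) (min R (x ξ)), by fun_prop⟩

lemma lipschitzWith_truncate (R : ℝ) : LipschitzWith 1 (truncate (Z := Z) R) := by
  refine LipschitzWith.of_dist_le_mul fun x y => ?_
  rw [NNReal.coe_one, one_mul]
  refine (ContinuousMap.dist_le dist_nonneg).2 fun ξ => ?_
  have h : dist (x ξ) (y ξ) ≤ dist x y := ContinuousMap.dist_apply_le_dist ξ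
  have h1 := abs_max_sub_max_le_abs (min R (x ξ)) (min R (y ξ)) (-R)
  have h2 := abs_min_sub_min_le_max R (x ξ) R (y ξ)
  rw [Real.dist_eq] at h ⊢
  simp only [sub_self, abs_zero] at h2
  rw [max_eq_right (abs_nonneg _)] at h2
  simp only [truncate, ContinuousMap.coe_mk]
  rw [max_comm (-R), max_comm (-R)]
  linarith

lemma norm_truncate_le {R : ℝ} (hR : 0 ≤ R) (x : C(Z, ℝ)) : ‖truncate R x‖ ≤ R :=
  (ContinuousMap.norm_le _ hR).2 fun ξ => by
    rw [Real.norm_eq_abs, abs_le]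
    exact ⟨le_max_left _ _, max_le (by linarith) (min_le_left _ _)⟩

lemma truncate_eq_self {R : ℝ} {x : C(Z, ℝ)} (hx : ‖x‖ ≤ R) : truncate R x = x := by
  ext ξ
  have h := (x.norm_coe_le_norm ξ).trans hx
  rw [Real.norm_eq_abs, abs_le] at h
  simp [truncate, h.1, h.2]

/-- A Lipschitz vector field on `C(Z, ℝ)` has solutions on every interval `[0, N]`. -/
lemma exists_solution_Icc {K : ℝ≥0} {v : C(Z, ℝ) → C(Z, ℝ)} (hv : LipschitzWith K v)
    (x₀ : C(Z, ℝ)) {N : ℝ} (hN : 0 ≤ N) :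
    ∃ α : ℝ → C(Z, ℝ), α 0 = x₀ ∧
      ∀ t ∈ Icc 0 N, HasDerivWithinAt α (v (α t)) (Icc 0 N) t := by
  have hgrowth : ∀ x, ‖v x‖ ≤ K * ‖x‖ + ‖v 0‖ := fun x => by
    have h := hv.dist_le_mul x 0
    rw [dist_eq_norm, dist_zero_right] at h
    have := norm_le_norm_sub_add (v x) (v 0)
    linarith
  set R := gronwallBound ‖x₀‖ K ‖v 0‖ N
  have hmono := gronwallBound_mono (norm_nonneg x₀) (norm_nonneg (v 0)) K.2
  have hR0 : 0 ≤ R := by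
    have h := hmono hN
    rw [gronwallBound_x0] at h
    exact (norm_nonneg _).trans h
  have hw : LipschitzWith K (fun x => v (truncate R x)) := by
    simpa [Function.comp_def] using hv.comp (lipschitzWith_truncate (Z := Z) R)
  have hL : 0 ≤ K * R + ‖v 0‖ := by positivity
  have hpl : IsPicardLindelof (fun _ x => v (truncate R x)) (⟨0, left_mem_Icc.2 hN⟩ : Icc 0 N) x₀
      (⟨_, hL⟩ * ⟨N, hN⟩) 0 ⟨_, hL⟩ K := by
    refine ⟨fun t _ => hw.lipschitzOnWith, fun x _ => continuousOn_const, fun t _ x _ => ?_, ?_⟩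
    · have h1 := hgrowth (truncate R x)
      have h2 := mul_le_mul_of_nonneg_left (norm_truncate_le hR0 x) K.2
      exact h1.trans (add_le_add_left h2 _)
    · simp only [sub_zero, sub_self, max_eq_left hN, NNReal.coe_zero]
      exact le_rfl
  obtain ⟨α, hα0, hα⟩ := hpl.exists_eq_forall_mem_Icc_hasDerivWithinAt₀
  have hα0' : α 0 = x₀ := hα0
  have hbound : ∀ t ∈ Icc 0 N, ‖α t‖ ≤ gronwallBound ‖x₀‖ K ‖v 0‖ (t - 0) := by
    refine norm_le_gronwallBound_of_norm_deriv_right_le (f' := fun t => v (truncate R (α t)))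
      (fun t ht => (hα t ht).continuousWithinAt) (fun t ht => ?_) (by rw [hα0'])
      fun t ht => (hgrowth _).trans ?_
    · exact (hα t ⟨ht.1, ht.2.le⟩).mono_of_mem_nhdsWithin (Icc_mem_nhdsGE_of_mem ht)
    · have h := (lipschitzWith_truncate (Z := Z) R).dist_le_mul (α t) 0
      rw [truncate_eq_self (x := 0) (by simpa using hR0)] at h
      rw [dist_zero_right, dist_zero_right, NNReal.coe_one, one_mul] at h
      gcongr
  refine ⟨α, hα0', fun t ht => ?_⟩
  have h := hα t ht
  rwa [truncate_eq_self] at h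
  have h1 := hbound t ht
  rw [sub_zero] at h1
  exact h1.trans (hmono ht.2)

lemma eqOn_Icc_of_solutions {K : ℝ≥0} {v : C(Z, ℝ) → C(Z, ℝ)} (hv : LipschitzWith K v)
    {α β : ℝ → C(Z, ℝ)} {N : ℝ} (h0 : α 0 = β 0)
    (hα : ∀ t ∈ Icc 0 N, HasDerivWithinAt α (v (α t)) (Icc 0 N) t)
    (hβ : ∀ t ∈ Icc 0 N, HasDerivWithinAt β (v (β t)) (Icc 0 N) t) : EqOn α β (Icc 0 N) :=
  ODE_solution_unique (v := fun _ => v) (fun _ => hv)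
    (fun t ht => (hα t ht).continuousWithinAt)
    (fun t ht => (hα t ⟨ht.1, ht.2.le⟩).mono_of_mem_nhdsWithin (Icc_mem_nhdsGE_of_mem ht))
    (fun t ht => (hβ t ht).continuousWithinAt)
    (fun t ht => (hβ t ⟨ht.1, ht.2.le⟩).mono_of_mem_nhdsWithin (Icc_mem_nhdsGE_of_mem ht)) h0

/-- A Lipschitz vector field on `C(Z, ℝ)` has solutions on `[0, ∞)`. -/
lemma exists_solution_Ici {K : ℝ≥0} {v : C(Z, ℝ) → C(Z, ℝ)} (hv : LipschitzWith K v)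
    (x₀ : C(Z, ℝ)) :
    ∃ α : ℝ → C(Z, ℝ), α 0 = x₀ ∧
      ∀ t ∈ Ici (0 : ℝ), HasDerivWithinAt α (v (α t)) (Ici 0) t := by
  choose α hα0 hα using fun n : ℕ => exists_solution_Icc hv x₀ n.cast_nonneg
  have hcompat : ∀ m n : ℕ, m ≤ n → EqOn (α m) (α n) (Icc 0 m) := fun m n hmn => by
    have hsub : Icc (0 : ℝ) m ⊆ Icc 0 n := Icc_subset_Icc_right (by exact_mod_cast hmn)
    exact eqOn_Icc_of_solutions hv (by rw [hα0, hα0]) (hα m)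
      fun t ht => (hα n t (hsub ht)).mono hsub
  set β : ℝ → C(Z, ℝ) := fun t => α ⌈t⌉₊ t
  have hβα : ∀ n : ℕ, EqOn β (α n) (Icc 0 n) := fun n t ht =>
    hcompat _ _ (Nat.ceil_le.2 ht.2) ⟨ht.1, Nat.le_ceil t⟩
  refine ⟨β, hα0 _, fun t ht => ?_⟩
  obtain ⟨n, hn⟩ := exists_nat_gt t
  have htn : t ∈ Icc (0 : ℝ) n := ⟨ht, hn.le⟩
  have h := (hα n t htn).congr (hβα n) (hβα n htn)
  rw [← hβα n htn] at h
  refine h.mono_of_mem_nhdsWithin ?_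
  rw [← Ici_inter_Iic]
  exact inter_mem_nhdsWithin _ (Iic_mem_nhds hn)

end GlobalExistence

lemma IsAntipodal.pos [TopologicalSpace Z] {ρ : Z → Z → ℝ} (hρ : IsAntipodal ρ) {ξ η : Z}
    (h : η ≠ ξ) : 0 < ρ ξ η :=
  lt_of_le_of_ne (hρ.toIsSeparating.nonneg ξ η)
    fun h0 => h ((hρ.toIsSeparating.eq_zero_iff ξ η).1 h0.symm).symm

lemma IsAntipodal.exp_discrepancy_term [TopologicalSpace Z] {ρ : Z → Z → ℝ}
    (hρ : IsAntipodal ρ) (τ : C(Z, ℝ)) {ξ η : Z} (h : η ≠ ξ) :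
    Real.exp (τ ξ + τ η + Real.log (ρ ξ η ^ 2)) = Real.exp (τ ξ + τ η) * ρ ξ η ^ 2 := by
  rw [Real.exp_add, Real.exp_log (pow_pos (hρ.pos h) 2)]

section Discrepancy

open Set

variable [TopologicalSpace Z] [CompactSpace Z] {ρ : Z → Z → ℝ}

lemma IsAntipodal.exists_isGreatest_discrepancy (hρ : IsAntipodal ρ) (τ : C(Z, ℝ)) (ξ : Z) :
    ∃ η, η ≠ ξ ∧ discrepancy ρ τ ξ = τ ξ + τ η + Real.log (ρ ξ η ^ 2) ∧
      (∀ ζ, ζ ≠ ξ → τ ξ + τ ζ + Real.log (ρ ξ ζ ^ 2) ≤ discrepancy ρ τ ξ) ∧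
      IsGreatest ((fun ζ => Real.exp (τ ξ + τ ζ) * ρ ξ ζ ^ 2) '' univ)
        (Real.exp (discrepancy ρ τ ξ)) := by
  have hc : Continuous fun ζ => Real.exp (τ ξ + τ ζ) * ρ ξ ζ ^ 2 := by
    have : Continuous fun ζ => ρ ξ ζ :=
      hρ.toIsSeparating.continuous.comp (Continuous.prodMk_right ξ)
    fun_prop
  obtain ⟨η, -, hη⟩ := isCompact_univ.exists_isMaxOn ⟨ξ, mem_univ ξ⟩ hc.continuousOn
  have hmax : ∀ ζ, Real.exp (τ ξ + τ ζ) * ρ ξ ζ ^ 2 ≤ Real.exp (τ ξ + τ η) * ρ ξ η ^ 2 :=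
    fun ζ => hη (mem_univ ζ)
  have hne : η ≠ ξ := by
    rintro rfl
    obtain ⟨ζ, hζ⟩ := hρ.antipode η
    have h := hmax ζ
    rw [hζ, (hρ.toIsSeparating.eq_zero_iff η η).2 rfl] at h
    have := Real.exp_pos (τ η + τ ζ)
    norm_num at h
    linarith
  have hle : ∀ ζ, ζ ≠ ξ → τ ξ + τ ζ + Real.log (ρ ξ ζ ^ 2) ≤
      τ ξ + τ η + Real.log (ρ ξ η ^ 2) := fun ζ hζ => by
    rw [← Real.exp_le_exp, hρ.exp_discrepancy_term τ hζ, hρ.exp_discrepancy_term τ hne]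
    exact hmax ζ
  have heq : discrepancy ρ τ ξ = τ ξ + τ η + Real.log (ρ ξ η ^ 2) := by
    have : Nonempty {η : Z // η ≠ ξ} := ⟨⟨η, hne⟩⟩
    refine le_antisymm (ciSup_le fun ζ => hle ζ.1 ζ.2) ?_
    exact le_ciSup (f := fun ζ : {η : Z // η ≠ ξ} => τ ξ + τ ζ.1 + Real.log (ρ ξ ζ.1 ^ 2))
      ⟨_, by rintro _ ⟨ζ, rfl⟩; exact hle ζ.1 ζ.2⟩ ⟨η, hne⟩
  refine ⟨η, hne, heq, fun ζ hζ => heq ▸ hle ζ hζ, ?_⟩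
  rw [heq, hρ.exp_discrepancy_term τ hne]
  exact ⟨⟨η, mem_univ η, rfl⟩, by rintro _ ⟨ζ, -, rfl⟩; exact hmax ζ⟩

lemma IsAntipodal.exists_discrepancy_eq (hρ : IsAntipodal ρ) (τ : C(Z, ℝ)) (ξ : Z) :
    ∃ η, η ≠ ξ ∧ discrepancy ρ τ ξ = τ ξ + τ η + Real.log (ρ ξ η ^ 2) :=
  let ⟨η, h, h', _⟩ := hρ.exists_isGreatest_discrepancy τ ξ
  ⟨η, h, h'⟩

lemma IsAntipodal.le_discrepancy (hρ : IsAntipodal ρ) (τ : C(Z, ℝ)) {ξ η : Z} (h : η ≠ ξ) :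
    τ ξ + τ η + Real.log (ρ ξ η ^ 2) ≤ discrepancy ρ τ ξ :=
  let ⟨_, _, _, h', _⟩ := hρ.exists_isGreatest_discrepancy τ ξ
  h' η h

lemma IsAntipodal.continuous_discrepancy (hρ : IsAntipodal ρ) (τ : C(Z, ℝ)) :
    Continuous (discrepancy ρ τ) := by
  have h : discrepancy ρ τ = fun ξ =>
      Real.log (sSup ((fun ζ => Real.exp (τ ξ + τ ζ) * ρ ξ ζ ^ 2) '' univ)) := by
    ext ξ
    obtain ⟨η, -, -, -, hg⟩ := hρ.exists_isGreatest_discrepancy τ ξ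
    rw [hg.csSup_eq, Real.log_exp]
  rw [h]
  refine Continuous.log (isCompact_univ.continuous_sSup ?_) fun ξ => ?_
  · have := hρ.toIsSeparating.continuous
    change Continuous fun p : Z × Z => Real.exp (τ p.1 + τ p.2) * ρ p.1 p.2 ^ 2
    fun_prop
  · obtain ⟨η, -, -, -, hg⟩ := hρ.exists_isGreatest_discrepancy τ ξ
    rw [hg.csSup_eq]
    exact (Real.exp_pos _).ne'

/-- The vector field `τ ↦ -D_ρ(τ)` of the antipodal flow. -/
noncomputable def flowField (hρ : IsAntipodal ρ) (τ : C(Z, ℝ)) : C(Z, ℝ) :=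
  ⟨fun ξ => -discrepancy ρ τ ξ, (hρ.continuous_discrepancy τ).neg⟩

@[simp]
lemma flowField_apply (hρ : IsAntipodal ρ) (τ : C(Z, ℝ)) (ξ : Z) :
    flowField hρ τ ξ = -discrepancy ρ τ ξ := rfl

lemma IsAntipodal.discrepancy_le_add (hρ : IsAntipodal ρ) (τ σ : C(Z, ℝ)) (ξ : Z) :
    discrepancy ρ τ ξ ≤ discrepancy ρ σ ξ + 2 * dist τ σ := by
  obtain ⟨η, hη, h⟩ := hρ.exists_discrepancy_eq τ ξ
  have h1 := hρ.le_discrepancy σ hη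
  have h2 : dist (τ ξ) (σ ξ) ≤ dist τ σ := ContinuousMap.dist_apply_le_dist ξ
  have h3 : dist (τ η) (σ η) ≤ dist τ σ := ContinuousMap.dist_apply_le_dist η
  rw [Real.dist_eq] at h2 h3
  have := le_abs_self (τ ξ - σ ξ)
  have := le_abs_self (τ η - σ η)
  linarith

lemma lipschitzWith_flowField (hρ : IsAntipodal ρ) : LipschitzWith 2 (flowField hρ) := by
  refine LipschitzWith.of_dist_le_mul fun τ σ => ?_
  refine (ContinuousMap.dist_le (by positivity)).2 fun ξ => ?_
  have h1 := hρ.discrepancy_le_add τ σ ξ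
  have h2 := hρ.discrepancy_le_add σ τ ξ
  rw [dist_comm] at h2
  rw [Real.dist_eq, abs_le]
  simp only [flowField_apply, NNReal.coe_ofNat]
  constructor <;> linarith

lemma isAntipodalFlowSol_iff (hρ : IsAntipodal ρ) (τ : ℝ → C(Z, ℝ)) :
    IsAntipodalFlowSol ρ τ ↔
      ∀ t ∈ Ici (0 : ℝ), HasDerivWithinAt τ (flowField hρ (τ t)) (Ici 0) t := by
  refine forall₂_congr fun t _ => ⟨?_, fun h => ⟨_, fun _ => rfl, h⟩⟩
  rintro ⟨τ', h, h'⟩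
  rwa [show flowField hρ (τ t) = τ' from ContinuousMap.ext fun ξ => (h ξ).symm]

lemma IsAntipodalFlowSol.eqOn (hρ : IsAntipodal ρ) {τ σ : ℝ → C(Z, ℝ)}
    (hτ : IsAntipodalFlowSol ρ τ) (hσ : IsAntipodalFlowSol ρ σ) (h0 : τ 0 = σ 0) :
    EqOn τ σ (Ici 0) := fun t ht => by
  rw [isAntipodalFlowSol_iff hρ] at hτ hσ
  exact eqOn_Icc_of_solutions (lipschitzWith_flowField hρ) h0
    (fun s hs => (hτ s hs.1).mono Icc_subset_Ici_self)
    (fun s hs => (hσ s hs.1).mono Icc_subset_Ici_self) (right_mem_Icc.2 ht)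

lemma IsAntipodalFlowSol.hasDerivWithinAt_apply {τ : ℝ → C(Z, ℝ)}
    (hτ : IsAntipodalFlowSol ρ τ) (ξ : Z) {t : ℝ} (ht : t ∈ Ici (0 : ℝ)) :
    HasDerivWithinAt (fun t => τ t ξ) (-discrepancy ρ (τ t) ξ) (Ici 0) t := by
  obtain ⟨τ', h, h'⟩ := hτ t ht
  rw [← h]
  exact (ContinuousMap.evalCLM ℝ ξ).hasFDerivAt.comp_hasDerivWithinAt t h'

end Discrepancy

section Convergence

open Set Real

variable [TopologicalSpace Z] [CompactSpace Z] {ρ : Z → Z → ℝ} {τ : ℝ → C(Z, ℝ)} {M : ℝ}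

lemma hasDerivWithinAt_exp_mul (c t : ℝ) (s : Set ℝ) :
    HasDerivWithinAt (fun t => exp (c * t)) (c * exp (c * t)) s t := by
  have h := ((hasDerivAt_id t).const_mul c).exp.hasDerivWithinAt (s := s)
  simpa [mul_comm] using h

lemma IsAntipodalFlowSol.discrepancy_le (hρ : IsAntipodal ρ) (hτ : IsAntipodalFlowSol ρ τ)
    (hM : ∀ ξ, discrepancy ρ (τ 0) ξ ≤ M) {t : ℝ} (ht : 0 ≤ t) (ξ : Z) :
    discrepancy ρ (τ t) ξ ≤ M * exp (-2 * t) := by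
  obtain ⟨η, hη, h⟩ := hρ.exists_discrepancy_eq (τ t) ξ
  have hd : ∀ s ∈ Ici (0 : ℝ), HasDerivWithinAt
      (fun s => -(exp (2 * s) * (τ s ξ + τ s η + log (ρ ξ η ^ 2))))
      (-(2 * exp (2 * s) * (τ s ξ + τ s η + log (ρ ξ η ^ 2)) +
        exp (2 * s) * (-discrepancy ρ (τ s) ξ + -discrepancy ρ (τ s) η))) (Ici 0) s :=
    fun s hs => ((hasDerivWithinAt_exp_mul 2 s _).mul
      (((hτ.hasDerivWithinAt_apply ξ hs).add (hτ.hasDerivWithinAt_apply η hs)).add_const _)).neg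
  have key := le_of_hasDerivWithinAt_Ici_nonneg hd le_rfl ht fun s _ => by
    have h1 := hρ.le_discrepancy (τ s) hη
    have h2 := hρ.le_discrepancy (τ s) hη.symm
    rw [hρ.toIsSeparating.symm η ξ] at h2
    nlinarith [exp_pos (2 * s)]
  have h0 := (hρ.le_discrepancy (τ 0) hη).trans (hM ξ)
  rw [← h] at key
  simp only [mul_zero, exp_zero, one_mul] at key
  rw [neg_mul, exp_neg, ← div_eq_mul_inv, le_div_iff₀ (exp_pos _)]
  linarith

lemma IsAntipodalFlowSol.le_discrepancy (hρ : IsAntipodal ρ) (hτ : IsAntipodalFlowSol ρ τ)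
    (hM : ∀ ξ, |discrepancy ρ (τ 0) ξ| ≤ M) {T : ℝ} (hT : 0 ≤ T) (ξ : Z) :
    -(2 * M) * exp (-T) ≤ discrepancy ρ (τ T) ξ := by
  have hM0 : 0 ≤ M := (abs_nonneg _).trans (hM ξ)
  have hup := fun t (ht : 0 ≤ t) => hτ.discrepancy_le hρ (fun ξ => (abs_le.1 (hM ξ)).2) ht
  have hF : ∀ t, 0 ≤ t → t ≤ T → discrepancy ρ (τ t) ξ - τ t ξ ≤
      discrepancy ρ (τ T) ξ - τ T ξ + M / 2 * exp (-2 * t) := fun t ht htT => by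
    obtain ⟨η, hη, h⟩ := hρ.exists_discrepancy_eq (τ t) ξ
    have h1 := hρ.le_discrepancy (τ T) hη
    have key := le_of_hasDerivWithinAt_Ici_nonneg
      (fun s hs => (hτ.hasDerivWithinAt_apply η hs).sub
        ((hasDerivWithinAt_exp_mul (-2) s _).const_mul (M / 2))) ht htT fun s hs => by
        have := hup s (ht.trans hs.1) η
        linarith
    simp only [Pi.sub_apply] at key
    have := mul_nonneg hM0 (exp_pos (-2 * T)).le
    linarith
  set F := discrepancy ρ (τ T) ξ - τ T ξ with hFdef
  have hd : ∀ s ∈ Ici (0 : ℝ), HasDerivWithinAt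
      (fun s => exp (1 * s) * (τ s ξ + F) - M / 2 * exp (-1 * s))
      (1 * exp (1 * s) * (τ s ξ + F) + exp (1 * s) * (-discrepancy ρ (τ s) ξ) -
        M / 2 * (-1 * exp (-1 * s))) (Ici 0) s := fun s hs =>
    ((hasDerivWithinAt_exp_mul 1 s _).mul ((hτ.hasDerivWithinAt_apply ξ hs).add_const _)).sub
      ((hasDerivWithinAt_exp_mul (-1) s _).const_mul (M / 2))
  have key := le_of_hasDerivWithinAt_Ici_nonneg hd le_rfl hT fun s hs => by
    have h1 := mul_le_mul_of_nonneg_left (hF s hs.1 hs.2) (exp_pos (1 * s)).le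
    have h2 : exp (1 * s) * exp (-2 * s) = exp (-1 * s) := by rw [← exp_add]; ring_nf
    rw [mul_add, mul_left_comm, h2] at h1
    linarith
  have h0 := hF 0 le_rfl hT
  have h0' := (abs_le.1 (hM ξ)).1
  simp only [mul_zero, exp_zero, one_mul, mul_one] at key h0
  have h3 : τ T ξ + F = discrepancy ρ (τ T) ξ := by rw [hFdef]; ring
  rw [h3] at key
  have := mul_nonneg hM0 (exp_pos (-1 * T)).le
  rw [exp_neg, ← div_eq_mul_inv, div_le_iff₀ (exp_pos _)]
  linarith

lemma IsAntipodalFlowSol.abs_discrepancy_le (hρ : IsAntipodal ρ) (hτ : IsAntipodalFlowSol ρ τ)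
    (hM : ∀ ξ, |discrepancy ρ (τ 0) ξ| ≤ M) {t : ℝ} (ht : 0 ≤ t) (ξ : Z) :
    |discrepancy ρ (τ t) ξ| ≤ 2 * M * exp (-1 * t) := by
  have hM0 : 0 ≤ M := (abs_nonneg _).trans (hM ξ)
  have h1 := hτ.discrepancy_le hρ (fun ξ => (abs_le.1 (hM ξ)).2) ht ξ
  have h2 := hτ.le_discrepancy hρ hM ht ξ
  have h3 : exp (-2 * t) ≤ exp (-1 * t) := exp_le_exp.2 (by linarith)
  have h4 := mul_le_mul_of_nonneg_left h3 hM0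
  have h5 := mul_nonneg hM0 (exp_pos (-1 * t)).le
  rw [abs_le]
  rw [← neg_one_mul t] at h2
  constructor <;> linarith

lemma IsAntipodalFlowSol.dist_le (hρ : IsAntipodal ρ) (hτ : IsAntipodalFlowSol ρ τ)
    (hM0 : 0 ≤ M) (hM : ∀ ξ, |discrepancy ρ (τ 0) ξ| ≤ M) {s t : ℝ} (hs : 0 ≤ s) (hst : s ≤ t) :
    dist (τ t) (τ s) ≤ 2 * M * exp (-1 * s) := by
  refine (ContinuousMap.dist_le (by positivity)).2 fun ξ => ?_
  have hb := fun r (hr : r ∈ Icc s t) =>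
    abs_le.1 (hτ.abs_discrepancy_le hρ hM (hs.trans hr.1) ξ)
  have h1 := le_of_hasDerivWithinAt_Ici_nonneg
    (fun r hr => (hτ.hasDerivWithinAt_apply ξ hr).sub
      ((hasDerivWithinAt_exp_mul (-1) r _).const_mul (2 * M))) hs hst fun r hr => by
    linarith [(hb r hr).2]
  have h2 := le_of_hasDerivWithinAt_Ici_nonneg
    (fun r hr => ((hτ.hasDerivWithinAt_apply ξ hr).add
      ((hasDerivWithinAt_exp_mul (-1) r _).const_mul (2 * M))).neg) hs hst fun r hr => by
    linarith [(hb r hr).1]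
  simp only [Pi.sub_apply, Pi.neg_apply, Pi.add_apply] at h1 h2
  have := mul_nonneg hM0 (exp_pos (-1 * t)).le
  rw [Real.dist_eq, abs_le]
  constructor <;> linarith

lemma IsAntipodalFlowSol.exists_tendsto (hρ : IsAntipodal ρ) (hτ : IsAntipodalFlowSol ρ τ) :
    ∃ σ, Tendsto τ atTop (𝓝 σ) := by
  set M := ‖flowField hρ (τ 0)‖
  have hM : ∀ ξ, |discrepancy ρ (τ 0) ξ| ≤ M := fun ξ => by
    simpa using (flowField hρ (τ 0)).norm_coe_le_norm ξ
  refine cauchySeq_tendsto_of_complete (Metric.cauchySeq_iff'.2 fun ε hε => ?_)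
  have hlim : Tendsto (fun s => 2 * M * exp (-1 * s)) atTop (𝓝 0) := by
    simpa using tendsto_exp_neg_atTop_nhds_zero.const_mul (2 * M)
  obtain ⟨N, hN, hN0⟩ := ((hlim.eventually (gt_mem_nhds hε)).and (eventually_ge_atTop 0)).exists
  exact ⟨N, fun t ht => (hτ.dist_le hρ (norm_nonneg _) hM hN0 ht).trans_lt hN⟩

lemma exists_antipodalFlowSol_tendsto (hρ : IsAntipodal ρ) (τ₀ : C(Z, ℝ)) :
    ∃ p : (ℝ → C(Z, ℝ)) × C(Z, ℝ), p.1 0 = τ₀ ∧ IsAntipodalFlowSol ρ p.1 ∧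
      Tendsto p.1 atTop (𝓝 p.2) := by
  obtain ⟨τ, h0, h⟩ := exists_solution_Ici (lipschitzWith_flowField hρ) τ₀
  have hτ := (isAntipodalFlowSol_iff hρ τ).2 h
  obtain ⟨σ, hσ⟩ := hτ.exists_tendsto hρ
  exact ⟨(τ, σ), h0, hτ, hσ⟩

lemma antipodalization_eq_eMap (hρ : IsAntipodal ρ) {σ : C(Z, ℝ)}
    (hτ : IsAntipodalFlowSol ρ τ) (hσ : Tendsto τ atTop (𝓝 σ)) :
    antipodalization ρ (τ 0) = eMap ρ σ := by
  have h : ∃ p : (ℝ → C(Z, ℝ)) × C(Z, ℝ), p.1 0 = τ 0 ∧ IsAntipodalFlowSol ρ p.1 ∧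
    Tendsto p.1 atTop (𝓝 p.2) := ⟨(τ, σ), rfl, hτ, hσ⟩
  rw [antipodalization, dif_pos h]
  obtain ⟨h0, hsol, hlim⟩ := h.choose_spec
  congr 1
  refine tendsto_nhds_unique (hlim.congr' ?_) hσ
  filter_upwards [eventually_ge_atTop 0] with t ht
  exact hsol.eqOn hρ hτ h0 ht

end Convergence

section Derivative

variable [TopologicalSpace Z] {ρ₀ ρ₁ ρ₂ : Z → Z → ℝ}

/-- The geometric mean value theorem: Moebius equivalent antipodal functions have a derivative. -/
lemma exists_derivative [T1Space Z] (h4 : HasFourPoints Z) (hρ₁ : ρ₁ ∈ MoebiusSpace ρ₀)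
    (hρ₂ : ρ₂ ∈ MoebiusSpace ρ₀) :
    ∃ f : Z → ℝ, Continuous f ∧ (∀ ξ, 0 < f ξ) ∧
      ∀ ξ η, ρ₁ ξ η ^ 2 = f ξ * f η * ρ₂ ξ η ^ 2 := by
  obtain ⟨p₁, p₂, p₃, p₄, h12, h13, h14, h23, h24, h34⟩ := h4
  set u : Z → Z → ℝ := fun ξ η => ρ₁ ξ η / ρ₂ ξ η with hu
  have hpos₁ : ∀ {ξ η}, ξ ≠ η → 0 < ρ₁ ξ η := fun h => hρ₁.1.pos h.symm
  have hpos₂ : ∀ {ξ η}, ξ ≠ η → 0 < ρ₂ ξ η := fun h => hρ₂.1.pos h.symm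
  have hupos : ∀ {ξ η}, ξ ≠ η → 0 < u ξ η := fun h => div_pos (hpos₁ h) (hpos₂ h)
  have husymm : ∀ ξ η, u ξ η = u η ξ := fun ξ η => by
    simp only [hu, hρ₁.1.toIsSeparating.symm ξ η, hρ₂.1.toIsSeparating.symm ξ η]
  have hcross : ∀ {ξ ξ' η η'}, ξ ≠ ξ' → ξ ≠ η → ξ ≠ η' → ξ' ≠ η → ξ' ≠ η' → η ≠ η' →
      u ξ η * u ξ' η' = u ξ η' * u ξ' η := by
    intro ξ ξ' η η' h1 h2 h3 h4 h5 h6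
    have h := (hρ₁.2 ξ ξ' η η' h1 h2 h3 h4 h5 h6).symm.trans (hρ₂.2 ξ ξ' η η' h1 h2 h3 h4 h5 h6)
    have := hpos₁ h2; have := hpos₁ h3; have := hpos₁ h4; have := hpos₁ h5
    have := hpos₂ h2; have := hpos₂ h3; have := hpos₂ h4; have := hpos₂ h5
    simp only [crossRatio] at h
    rw [div_eq_div_iff (by positivity) (by positivity)] at h
    simp only [hu]
    field_simp
    linarith
  set F : Z → Z → Z → ℝ := fun ξ a b => u ξ a * u ξ b / u a b with hF
  have hFsymm : ∀ ξ a b, F ξ a b = F ξ b a := fun ξ a b => by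
    simp only [hF, husymm a b]; ring
  have hFright : ∀ {ξ a b c}, a ≠ ξ → b ≠ ξ → c ≠ ξ → a ≠ b → a ≠ c → F ξ a b = F ξ a c := by
    intro ξ a b c ha hb hc hab hac
    rcases eq_or_ne b c with rfl | hbc
    · rfl
    have h := hcross ha.symm hb.symm hc.symm hab hac hbc
    simp only [hF]
    rw [div_eq_div_iff (hupos hab).ne' (hupos hac).ne']
    linear_combination u ξ a * h
  have hFindep : ∀ {ξ a b c d}, a ≠ ξ → b ≠ ξ → c ≠ ξ → d ≠ ξ → a ≠ b → c ≠ d →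
      F ξ a b = F ξ c d := by
    intro ξ a b c d ha hb hc hd hab hcd
    rcases eq_or_ne a c with rfl | hac
    · exact hFright ha hb hd hab hcd
    · rw [hFright ha hb hc hab hac, hFsymm, hFright hc ha hd hac.symm hcd]
  have hpair : ∀ ξ : Z, ∃ a b, a ≠ ξ ∧ b ≠ ξ ∧ a ≠ b := fun ξ => by
    by_cases h1 : p₁ = ξ
    · exact ⟨p₂, p₃, fun h => h12 (h1.trans h.symm), fun h => h13 (h1.trans h.symm), h23⟩
    by_cases h2 : p₂ = ξ
    · exact ⟨p₁, p₃, h1, fun h => h23 (h2.trans h.symm), h13⟩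
    exact ⟨p₁, p₂, h1, h2, h12⟩
  choose A B hA hB hAB using hpair
  have hf : ∀ {ξ a b}, a ≠ ξ → b ≠ ξ → a ≠ b → F ξ (A ξ) (B ξ) = F ξ a b := fun ha hb hab =>
    hFindep (hA _) (hB _) ha hb (hAB _) hab
  have hthird : ∀ ξ η : Z, ∃ c, c ≠ ξ ∧ c ≠ η := fun ξ η => by
    by_cases h1 : p₁ ≠ ξ ∧ p₁ ≠ η
    · exact ⟨p₁, h1⟩
    by_cases h2 : p₂ ≠ ξ ∧ p₂ ≠ η
    · exact ⟨p₂, h2⟩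
    refine ⟨p₃, ?_, ?_⟩ <;> rintro rfl <;> grind
  refine ⟨fun ξ => F ξ (A ξ) (B ξ), continuous_iff_continuousAt.2 fun ξ => ?_, fun ξ =>
    div_pos (mul_pos (hupos (hA ξ).symm) (hupos (hB ξ).symm)) (hupos (hAB ξ)), fun ξ η => ?_⟩
  · have hcont : ∀ a, a ≠ ξ → ContinuousAt (fun ζ => u ζ a) ξ := fun a ha =>
      ((hρ₁.1.toIsSeparating.continuous.comp (Continuous.prodMk_left a)).continuousAt).div
        ((hρ₂.1.toIsSeparating.continuous.comp (Continuous.prodMk_left a)).continuousAt)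
        (hpos₂ ha.symm).ne'
    refine (((hcont _ (hA ξ)).mul (hcont _ (hB ξ))).div_const
      (u (A ξ) (B ξ))).congr ?_
    filter_upwards [isOpen_ne.mem_nhds (hA ξ).symm, isOpen_ne.mem_nhds (hB ξ).symm] with ζ h1 h2
    exact (hf h1.symm h2.symm (hAB ξ)).symm
  · rcases eq_or_ne ξ η with rfl | hne
    · rw [(hρ₁.1.toIsSeparating.eq_zero_iff ξ ξ).2 rfl, (hρ₂.1.toIsSeparating.eq_zero_iff ξ ξ).2 rfl]
      ring
    obtain ⟨c, hcξ, hcη⟩ := hthird ξ η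
    have h1 := hupos hne
    have h2 := hupos hcξ.symm
    have h3 := hupos hcη.symm
    have h4 : F ξ (A ξ) (B ξ) * F η (A η) (B η) = u ξ η ^ 2 := by
      rw [hf hne.symm hcξ hcη.symm, hf hne hcη hcξ.symm]
      simp only [hF]
      rw [husymm η ξ]
      field_simp
    simp only [h4, hu]
    have := hpos₂ hne
    field_simp

lemma mDeriv_spec [T1Space Z] (h4 : HasFourPoints Z) (hρ₁ : ρ₁ ∈ MoebiusSpace ρ₀)
    (hρ₂ : ρ₂ ∈ MoebiusSpace ρ₀) :
    (∀ ξ, 0 < mDeriv ρ₂ ρ₁ ξ) ∧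
      ∀ ξ η, ρ₁ ξ η ^ 2 = mDeriv ρ₂ ρ₁ ξ * mDeriv ρ₂ ρ₁ η * ρ₂ ξ η ^ 2 := by
  have h := exists_derivative h4 hρ₁ hρ₂
  rw [mDeriv, dif_pos h]
  exact h.choose_spec.2

end Derivative

section ChangeOfBase

variable [TopologicalSpace Z] {ρ₁ ρ₂ : Z → Z → ℝ} {g : C(Z, ℝ)}

lemma eMap_add_eq (h₁ : IsSeparating ρ₁) (h₂ : IsSeparating ρ₂)
    (hg : ∀ ξ η, ρ₁ ξ η ^ 2 = Real.exp (g ξ + g η) * ρ₂ ξ η ^ 2) (τ : C(Z, ℝ)) :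
    eMap ρ₂ (τ + g) = eMap ρ₁ τ := by
  ext ξ η
  have h : ρ₁ ξ η = Real.exp (g ξ / 2) * Real.exp (g η / 2) * ρ₂ ξ η := by
    refine (pow_left_inj₀ (h₁.nonneg ξ η)
      (mul_nonneg (by positivity) (h₂.nonneg ξ η)) two_ne_zero).1 ?_
    rw [hg, mul_pow, ← Real.exp_add, ← Real.exp_nat_mul]
    congr 2
    push_cast
    ring
  simp only [eMap, h, ContinuousMap.add_apply, add_div, Real.exp_add]
  ring

lemma discrepancy_add_eq (h₂ : IsSeparating ρ₂)
    (hg : ∀ ξ η, ρ₁ ξ η ^ 2 = Real.exp (g ξ + g η) * ρ₂ ξ η ^ 2) (τ : C(Z, ℝ)) :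
    discrepancy ρ₂ (τ + g) = discrepancy ρ₁ τ := by
  ext ξ
  refine iSup_congr fun η => ?_
  have hne : ρ₂ ξ η.1 ^ 2 ≠ 0 :=
    pow_ne_zero 2 fun h => η.2 ((h₂.eq_zero_iff ξ η.1).1 h).symm
  rw [hg, Real.log_mul (Real.exp_pos _).ne' hne, Real.log_exp, ContinuousMap.add_apply,
    ContinuousMap.add_apply]
  ring

lemma IsAntipodalFlowSol.add_const [CompactSpace Z] {τ : ℝ → C(Z, ℝ)} (h₂ : IsSeparating ρ₂)
    (hg : ∀ ξ η, ρ₁ ξ η ^ 2 = Real.exp (g ξ + g η) * ρ₂ ξ η ^ 2) (hτ : IsAntipodalFlowSol ρ₁ τ) :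
    IsAntipodalFlowSol ρ₂ fun t => τ t + g := fun t ht => by
  obtain ⟨τ', h, h'⟩ := hτ t ht
  exact ⟨τ', by rwa [discrepancy_add_eq h₂ hg], h'.add_const g⟩

end ChangeOfBase

theorem statement8 [TopologicalSpace Z] [CompactSpace Z]
    [TopologicalSpace.MetrizableSpace Z] (h4 : HasFourPoints Z)
    (ρ₀ : Z → Z → ℝ) (h₀ : IsAntipodal ρ₀)
    (ρ₁ ρ₂ : Z → Z → ℝ) (hρ₁ : ρ₁ ∈ MoebiusSpace ρ₀) (hρ₂ : ρ₂ ∈ MoebiusSpace ρ₀)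
    (g : C(Z, ℝ)) (hg : ∀ ξ, g ξ = Real.log (mDeriv ρ₂ ρ₁ ξ)) :
    ∀ τ₀ : C(Z, ℝ), antipodalization ρ₂ (τ₀ + g) = antipodalization ρ₁ τ₀ := by
  intro τ₀
  obtain ⟨hpos, hmul⟩ := mDeriv_spec h4 hρ₁ hρ₂
  have hg' : ∀ ξ η, ρ₁ ξ η ^ 2 = Real.exp (g ξ + g η) * ρ₂ ξ η ^ 2 := fun ξ η => by
    rw [hmul, Real.exp_add, hg, hg, Real.exp_log (hpos ξ), Real.exp_log (hpos η)]
  obtain ⟨⟨τ, σ⟩, rfl, hτ, hσ⟩ := exists_antipodalFlowSol_tendsto hρ₁.1 τ₀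
  rw [antipodalization_eq_eMap hρ₁.1 hτ hσ,
    antipodalization_eq_eMap hρ₂.1 (hτ.add_const hρ₂.1.toIsSeparating hg') (hσ.add_const g),
    eMap_add_eq hρ₁.1.toIsSeparating hρ₂.1.toIsSeparating hg']
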